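/- Let K_n be the complete graph on n vertices with n ≥ 4. Then μ(I_{K_n}) = 2·C(n,4) = n(n−1)(n−2)(n−3)/12, and the binomial arithmetical rank and the K_n-homogeneous arithmetical rank of the toric ideal I_{K_n} satisfy bar(I_{K_n}) = ara_{K_n}(I_{K_n}) = n(n−1)(n−2)(n−3)/12. -/

import Mathlib

open MvPolynomial

noncomputable section

/-- The exponent of the variable `t j` in the image of `x i`: it is `1` if the vertex `j`
is an endpoint of the edge `e i`, and `0` otherwise (incidence vector of the edge `e i`). -/
def incid {n m : ℕ} (e : Fin m → Sym2 (Fin n)) (i : Fin m) (j : Fin n) : ℕ :=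
  if j ∈ e i then 1 else 0

/-- The `K`-algebra homomorphism `K[x_1,…,x_m] → K[t_1,…,t_n]` sending `x i` to
`t_j t_k`, where `e i = {v_j, v_k}`. -/
def toricMap (K : Type*) [CommRing K] {n m : ℕ} (e : Fin m → Sym2 (Fin n)) :
    MvPolynomial (Fin m) K →ₐ[K] MvPolynomial (Fin n) K :=
  aeval fun i => ∏ j, X j ^ incid e i j

/-- The toric ideal `I_G` of the graph with edges `e`. -/
def toricIdeal (K : Type*) [CommRing K] {n m : ℕ} (e : Fin m → Sym2 (Fin n)) :
    Ideal (MvPolynomial (Fin m) K) :=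
  RingHom.ker (toricMap K e)

/-- The minimal number of generators of an ideal. -/
def mu {R : Type*} [CommRing R] (I : Ideal R) : ℕ :=
  sInf {s | ∃ F : Fin s → R, Ideal.span (Set.range F) = I}

/-- A binomial is a difference of two monomials. -/
def IsBinomial {K : Type*} [CommRing K] {σ : Type*} (p : MvPolynomial σ K) : Prop :=
  ∃ u v : σ →₀ ℕ, p = monomial u 1 - monomial v 1

/-- The binomial arithmetical rank: the least `s` such that there are `s` binomials in `I`
generating `I` up to radical. -/
def bar {K : Type*} [CommRing K] {σ : Type*} (I : Ideal (MvPolynomial σ K)) : ℕ :=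
  sInf {s | ∃ F : Fin s → MvPolynomial σ K, (∀ i, IsBinomial (F i)) ∧ (∀ i, F i ∈ I) ∧
    (Ideal.span (Set.range F)).radical = I}

/-- The `G`-degree of an exponent vector `u`: `deg_G(x^u) = u_1 a_1 + ⋯ + u_m a_m ∈ ℤ^n`. -/
def degG {n m : ℕ} (e : Fin m → Sym2 (Fin n)) (u : Fin m →₀ ℕ) : Fin n → ℤ :=
  fun j => ∑ i, (u i : ℤ) * (incid e i j : ℤ)

/-- A polynomial is `G`-homogeneous if all monomials appearing in it have the same
`G`-degree. -/
def IsGHomogeneous {K : Type*} [CommRing K] {n m : ℕ} (e : Fin m → Sym2 (Fin n))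
    (p : MvPolynomial (Fin m) K) : Prop :=
  ∀ u ∈ p.support, ∀ v ∈ p.support, degG e u = degG e v

/-- The `G`-homogeneous arithmetical rank: the least `s` such that there are `s`
`G`-homogeneous polynomials in `I` generating `I` up to radical. -/
def araG {K : Type*} [CommRing K] {n m : ℕ} (e : Fin m → Sym2 (Fin n))
    (I : Ideal (MvPolynomial (Fin m) K)) : ℕ :=
  sInf {s | ∃ F : Fin s → MvPolynomial (Fin m) K, (∀ i, IsGHomogeneous e (F i)) ∧
    (∀ i, F i ∈ I) ∧ (Ideal.span (Set.range F)).radical = I}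

/-! ### The degree map -/

/-- The degree of an exponent vector, as an exponent vector of `K[t]`. -/
def degD {n m : ℕ} (e : Fin m → Sym2 (Fin n)) (u : Fin m →₀ ℕ) : Fin n →₀ ℕ :=
  ∑ i, u i • Finsupp.equivFunOnFinite.symm (fun j => incid e i j)

lemma degD_apply {n m : ℕ} (e : Fin m → Sym2 (Fin n)) (u : Fin m →₀ ℕ) (j : Fin n) :
    degD e u j = ∑ i, u i * incid e i j := by
  simp [degD, Finsupp.finsetSum_apply]

lemma degD_add {n m : ℕ} (e : Fin m → Sym2 (Fin n)) (u v : Fin m →₀ ℕ) :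
    degD e (u + v) = degD e u + degD e v := by
  simp [degD, add_smul, Finset.sum_add_distrib]

lemma degG_eq_iff {n m : ℕ} (e : Fin m → Sym2 (Fin n)) (u v : Fin m →₀ ℕ) :
    degG e u = degG e v ↔ degD e u = degD e v := by
  constructor
  · intro h
    ext j
    have := congrFun h j
    rw [degD_apply, degD_apply]
    simp only [degG] at this
    exact_mod_cast this
  · intro h
    funext j
    have := DFunLike.congr_fun h j
    rw [degD_apply, degD_apply] at this
    simp only [degG]
    exact_mod_cast this

lemma degD_ne_zero {n m : ℕ} (e : Fin m → Sym2 (Fin n)) (u : Fin m →₀ ℕ) (j : Fin n) :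
    degD e u j ≠ 0 ↔ ∃ i, u i ≠ 0 ∧ j ∈ e i := by
  rw [degD_apply]
  simp [incid, and_comm]

lemma toricMap_monomial {K : Type*} [CommRing K] {n m : ℕ} (e : Fin m → Sym2 (Fin n))
    (u : Fin m →₀ ℕ) (c : K) :
    toricMap K e (monomial u c) = monomial (degD e u) c := by
  have h : ∀ i : Fin m, (∏ j, (X j : MvPolynomial (Fin n) K) ^ incid e i j) =
      monomial (Finsupp.equivFunOnFinite.symm (fun j => incid e i j)) 1 := by
    intro i
    rw [monomial_eq, Finsupp.prod_fintype _ _ (by simp)]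
    simp
  unfold toricMap
  rw [aeval_monomial, Finsupp.prod_fintype _ _ (by simp)]
  simp only [h, monomial_pow, one_pow]
  rw [← monomial_sum_one]
  simp [degD, algebraMap_eq, C_mul_monomial]

lemma toricMap_coeff_zero {K : Type*} [Field K] {n m : ℕ} (e : Fin m → Sym2 (Fin n))
    (u v : Fin m →₀ ℕ) :
    (monomial u (1 : K) - monomial v 1) ∈ toricIdeal K e ↔ degD e u = degD e v := by
  rw [toricIdeal, RingHom.mem_ker]
  rw [map_sub, toricMap_monomial, toricMap_monomial, sub_eq_zero]
  rw [monomial_left_inj one_ne_zero]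

lemma exists_add_single {m : ℕ} (u : Fin m →₀ ℕ) (i : Fin m) (h : u i ≠ 0) :
    ∃ w, u = Finsupp.single i 1 + w := by
  refine ⟨u - Finsupp.single i 1, ?_⟩
  rw [add_tsub_cancel_of_le]
  rw [Finsupp.single_le_iff]
  omega

/-! ### Structure on the complete graph -/

/-- `idx a b` is the index of the edge `{a, b}`. -/
structure IsIdx {n m : ℕ} (e : Fin m → Sym2 (Fin n)) (idx : Fin n → Fin n → Fin m) : Prop where
  inj : Function.Injective e
  spec : ∀ a b, a ≠ b → e (idx a b) = s(a, b)
  surj : ∀ i, ∃ a b, a ≠ b ∧ i = idx a b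

lemma IsIdx.symm {n m : ℕ} {e : Fin m → Sym2 (Fin n)} {idx : Fin n → Fin n → Fin m}
    (H : IsIdx e idx) {a b : Fin n} (h : a ≠ b) : idx a b = idx b a := by
  apply H.inj
  rw [H.spec _ _ h, H.spec _ _ h.symm, Sym2.eq_swap]

lemma IsIdx.eq_iff {n m : ℕ} {e : Fin m → Sym2 (Fin n)} {idx : Fin n → Fin n → Fin m}
    (H : IsIdx e idx) {a b c d : Fin n} (h : a ≠ b) (h' : c ≠ d) :
    idx a b = idx c d ↔ (a = c ∧ b = d) ∨ (a = d ∧ b = c) := by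
  rw [← H.inj.eq_iff, H.spec _ _ h, H.spec _ _ h']
  simp

lemma IsIdx.sum_incid {n m : ℕ} {e : Fin m → Sym2 (Fin n)} {idx : Fin n → Fin n → Fin m}
    (H : IsIdx e idx) (i : Fin m) : ∑ j, incid e i j = 2 := by
  obtain ⟨a, b, hab, rfl⟩ := H.surj i
  simp only [incid, H.spec _ _ hab, Sym2.mem_iff]
  rw [Finset.sum_boole]
  have : (Finset.univ.filter fun x : Fin n => x = a ∨ x = b) = {a, b} := by
    ext; simp
  rw [this, Finset.card_pair hab]
  rfl

lemma IsIdx.sum_degD {n m : ℕ} {e : Fin m → Sym2 (Fin n)} {idx : Fin n → Fin n → Fin m}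
    (H : IsIdx e idx) (u : Fin m →₀ ℕ) : ∑ j, degD e u j = 2 * ∑ i, u i := by
  simp only [degD_apply]
  rw [Finset.sum_comm]
  simp only [← Finset.mul_sum, H.sum_incid]
  rw [Finset.mul_sum]
  exact Finset.sum_congr rfl fun _ _ => mul_comm _ _

lemma IsIdx.exists_nbr {n m : ℕ} {e : Fin m → Sym2 (Fin n)} {idx : Fin n → Fin n → Fin m}
    (H : IsIdx e idx) (u : Fin m →₀ ℕ) (a : Fin n) (h : degD e u a ≠ 0) :
    ∃ c, a ≠ c ∧ u (idx a c) ≠ 0 := by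
  obtain ⟨i, hi, ha⟩ := (degD_ne_zero e u a).1 h
  obtain ⟨b, c, hbc, rfl⟩ := H.surj i
  rw [H.spec _ _ hbc, Sym2.mem_iff] at ha
  rcases ha with rfl | rfl
  · exact ⟨c, hbc, hi⟩
  · exact ⟨b, hbc.symm, by rwa [H.symm hbc.symm]⟩

lemma IsIdx.exists_avoid {n m : ℕ} {e : Fin m → Sym2 (Fin n)} {idx : Fin n → Fin n → Fin m}
    (H : IsIdx e idx) (u v : Fin m →₀ ℕ) (huv : degD e u = degD e v) (i : Fin m) (hi : v i ≠ 0)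
    (c : Fin n) (hc : c ∉ e i) : ∃ k, u k ≠ 0 ∧ c ∉ e k := by
  by_contra! hcon
  have h1 : degD e u c = ∑ k, u k := by
    rw [degD_apply]
    refine Finset.sum_congr rfl fun k _ => ?_
    by_cases hk : u k = 0
    · simp [hk]
    · simp [incid, hcon k hk]
  have h2 : degD e v c < ∑ k, v k := by
    rw [degD_apply]
    refine Finset.sum_lt_sum (fun k _ => ?_) ⟨i, Finset.mem_univ _, ?_⟩
    · unfold incid; split_ifs <;> simp
    · simp [incid, hc]; omega
  have h3 := H.sum_degD u
  have h4 := H.sum_degD v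
  rw [huv] at h1 h3
  omega

section Quot

variable {K : Type*} [Field K] {n m : ℕ} {e : Fin m → Sym2 (Fin n)}
  {idx : Fin n → Fin n → Fin m}

/-- Class of a monomial modulo `J`. -/
def mkM (J : Ideal (MvPolynomial (Fin m) K)) (u : Fin m →₀ ℕ) : MvPolynomial (Fin m) K ⧸ J :=
  Ideal.Quotient.mk J (monomial u 1)

lemma mkM_add (J : Ideal (MvPolynomial (Fin m) K)) (u v : Fin m →₀ ℕ) :
    mkM J (u + v) = mkM J u * mkM J v := by
  simp [mkM, ← map_mul, monomial_mul]

/-- The swap property of an ideal. -/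
def SwapIdeal (J : Ideal (MvPolynomial (Fin m) K)) (idx : Fin n → Fin n → Fin m) : Prop :=
  ∀ a b c d : Fin n, a ≠ b → a ≠ c → a ≠ d → b ≠ c → b ≠ d → c ≠ d →
    mkM J (Finsupp.single (idx a b) 1) * mkM J (Finsupp.single (idx c d) 1) =
    mkM J (Finsupp.single (idx a c) 1) * mkM J (Finsupp.single (idx b d) 1)

lemma exists_two (u : Fin m →₀ ℕ) {i j : Fin m} (hij : i ≠ j) (hi : u i ≠ 0) (hj : u j ≠ 0) :
    ∃ w, u = Finsupp.single i 1 + (Finsupp.single j 1 + w) := by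
  obtain ⟨w, rfl⟩ := exists_add_single u i hi
  have : w j ≠ 0 := by simpa [Finsupp.single_apply, hij] using hj
  obtain ⟨w', rfl⟩ := exists_add_single w j this
  exact ⟨w', rfl⟩

/-- If `u` contains edges `ac` and `bd` with `a,b,c,d` distinct, `ab` can be split off. -/
lemma split_of_two (H : IsIdx e idx) (J : Ideal (MvPolynomial (Fin m) K)) (hJ : SwapIdeal J idx)
    (u : Fin m →₀ ℕ) {a b c d : Fin n} (hab : a ≠ b) (hac : a ≠ c) (had : a ≠ d) (hbc : b ≠ c)
    (hbd : b ≠ d) (hcd : c ≠ d) (h1 : u (idx a c) ≠ 0) (h2 : u (idx b d) ≠ 0) :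
    ∃ w, mkM J u = mkM J (Finsupp.single (idx a b) 1 + w) := by
  have hne : idx a c ≠ idx b d := by
    rw [Ne, H.eq_iff hac hbd]; tauto
  obtain ⟨w, rfl⟩ := exists_two u hne h1 h2
  refine ⟨Finsupp.single (idx c d) 1 + w, ?_⟩
  simp only [mkM_add, ← mul_assoc]
  rw [hJ a b c d hab hac had hbc hbd hcd]

lemma split_edge (H : IsIdx e idx) (J : Ideal (MvPolynomial (Fin m) K)) (hJ : SwapIdeal J idx)
    (u v : Fin m →₀ ℕ) (huv : degD e u = degD e v) {a b : Fin n} (hab : a ≠ b)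
    (hv : v (idx a b) ≠ 0) :
    ∃ w, mkM J u = mkM J (Finsupp.single (idx a b) 1 + w) := by
  by_cases hu : u (idx a b) = 0
  swap
  · obtain ⟨w, hw⟩ := exists_add_single u _ hu
    exact ⟨w, by rw [← hw]⟩
  have ha : degD e u a ≠ 0 := by
    rw [huv, degD_ne_zero]; exact ⟨_, hv, by simp [H.spec _ _ hab]⟩
  have hb : degD e u b ≠ 0 := by
    rw [huv, degD_ne_zero]; exact ⟨_, hv, by simp [H.spec _ _ hab]⟩
  obtain ⟨c, hac, hc⟩ := H.exists_nbr u a ha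
  obtain ⟨d, hbd, hd⟩ := H.exists_nbr u b hb
  have hbc : b ≠ c := by rintro rfl; exact hc hu
  have had : a ≠ d := by rintro rfl; rw [H.symm hbd] at hd; exact hd hu
  by_cases hcd : c = d
  swap
  · exact split_of_two H J hJ u hab hac had hbc hbd hcd hc hd
  subst hcd
  obtain ⟨k, hk, hck⟩ := H.exists_avoid u v huv (idx a b) hv c (by
    rw [H.spec _ _ hab]; simp [hac.symm, hbc.symm])
  have key : ∃ p q, p ≠ q ∧ k = idx p q ∧ p ≠ a ∧ p ≠ b := by
    obtain ⟨p, q, hpq, rfl⟩ := H.surj k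
    by_cases hp : p ≠ a ∧ p ≠ b
    · exact ⟨p, q, hpq, rfl, hp⟩
    · refine ⟨q, p, hpq.symm, H.symm hpq, ?_⟩
      have : ¬ (idx p q = idx a b) := by intro h; rw [h] at hk; exact hk hu
      rw [H.eq_iff hpq hab] at this
      have := hpq
      constructor <;> rintro rfl <;> tauto
  obtain ⟨p, q, hpq, rfl, hpa, hpb⟩ := key
  rw [H.spec _ _ hpq, Sym2.mem_iff, not_or] at hck
  obtain ⟨hcp, hcq⟩ := hck
  by_cases hqa : q = a
  · subst hqa
    rw [H.symm hpq] at hk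
    exact split_of_two H J hJ u hab hpa.symm hac hpb.symm hbc (Ne.symm hcp) hk hd
  by_cases hqb : q = b
  · subst hqb
    rw [H.symm hpq] at hk
    exact split_of_two H J hJ u hab hac hpa.symm hbc hpb.symm hcp hc hk
  have hne : idx a c ≠ idx p q := by
    rw [Ne, H.eq_iff hac hpq]; tauto
  obtain ⟨w, hw⟩ := exists_two u hne hc hk
  have hw' : w (idx b c) ≠ 0 := by
    rw [hw] at hd
    have h1 : idx a c ≠ idx b c := by rw [Ne, H.eq_iff hac hbc]; tauto
    have h2 : idx p q ≠ idx b c := by rw [Ne, H.eq_iff hpq hbc]; tauto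
    simpa [Finsupp.single_apply, h1, h2] using hd
  have h3 : mkM J u = mkM J (Finsupp.single (idx a p) 1 + (Finsupp.single (idx c q) 1 + w)) := by
    rw [hw]
    simp only [mkM_add, ← mul_assoc]
    rw [hJ a c p q hac hpa.symm (Ne.symm hqa) hcp hcq hpq]
  rw [h3]
  refine split_of_two H J hJ _ hab hpa.symm hac hpb.symm hbc (Ne.symm hcp) ?_ ?_
  · simp
  · simp [hw']

lemma degD_of_mkM (J : Ideal (MvPolynomial (Fin m) K)) (hJI : J ≤ toricIdeal K e)
    (u v : Fin m →₀ ℕ) (h : mkM J u = mkM J v) : degD e u = degD e v := by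
  rw [mkM, mkM, Ideal.Quotient.eq] at h
  exact (toricMap_coeff_zero e u v).1 (hJI h)

lemma mkM_eq_of_degD (H : IsIdx e idx) (J : Ideal (MvPolynomial (Fin m) K))
    (hJ : SwapIdeal J idx) (hJI : J ≤ toricIdeal K e) :
    ∀ (N : ℕ) (u v : Fin m →₀ ℕ), ∑ i, v i = N → degD e u = degD e v → mkM J u = mkM J v := by
  intro N
  induction N with
  | zero =>
    intro u v hv huv
    have hu := H.sum_degD u
    rw [huv, H.sum_degD v, hv] at hu
    have h1 : u = 0 := by
      ext i
      exact (Finset.sum_eq_zero_iff.1 (by omega : ∑ i, u i = 0)) i (Finset.mem_univ _)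
    have h2 : v = 0 := by
      ext i
      exact (Finset.sum_eq_zero_iff.1 hv) i (Finset.mem_univ _)
    rw [h1, h2]
  | succ N ih =>
    intro u v hv huv
    obtain ⟨i, -, hi⟩ : ∃ i ∈ Finset.univ, v i ≠ 0 := by
      apply Finset.exists_ne_zero_of_sum_ne_zero
      omega
    obtain ⟨a, b, hab, rfl⟩ := H.surj i
    obtain ⟨w, hw⟩ := split_edge H J hJ u v huv hab hi
    obtain ⟨v', rfl⟩ := exists_add_single v _ hi
    rw [hw, mkM_add, mkM_add]
    congr 1
    apply ih
    · simp [Finset.sum_add_distrib, Finsupp.single_apply] at hv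
      omega
    · have := degD_of_mkM J hJI _ _ hw
      rw [huv, degD_add, degD_add] at this
      exact (add_left_cancel this).symm

lemma toricIdeal_le (H : IsIdx e idx) (J : Ideal (MvPolynomial (Fin m) K))
    (hJ : SwapIdeal J idx) (hJI : J ≤ toricIdeal K e) : toricIdeal K e ≤ J := by
  let r : (Fin n →₀ ℕ) → (Fin m →₀ ℕ) := Function.invFun (degD e)
  let ψ : MvPolynomial (Fin n) K →ₗ[K] (MvPolynomial (Fin m) K ⧸ J) :=
    (basisMonomials (Fin n) K).constr K (fun d => mkM J (r d))
  have h : ψ ∘ₗ (toricMap K e).toLinearMap = (Ideal.Quotient.mkₐ K J).toLinearMap := by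
    apply (basisMonomials (Fin m) K).ext
    intro u
    have h1 : ψ (monomial (degD e u) 1) = mkM J (r (degD e u)) := by
      have := (basisMonomials (Fin n) K).constr_basis K (fun d => mkM J (r d)) (degD e u)
      simpa using this
    simp only [coe_basisMonomials, LinearMap.comp_apply, AlgHom.toLinearMap_apply,
      toricMap_monomial, h1]
    exact mkM_eq_of_degD H J hJ hJI _ _ _ rfl (Function.invFun_eq ⟨u, rfl⟩)
  intro f hf
  rw [toricIdeal, RingHom.mem_ker] at hf
  have := LinearMap.congr_fun h f
  simp only [LinearMap.comp_apply, AlgHom.toLinearMap_apply] at this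
  rw [hf, map_zero] at this
  exact Ideal.Quotient.eq_zero_iff_mem.1 this.symm

end Quot
section Quadrics

set_option linter.unusedSimpArgs false

variable {K : Type*} [Field K] {n m : ℕ} {e : Fin m → Sym2 (Fin n)}
  {idx : Fin n → Fin n → Fin m}

/-- Exponent vector of `x_{ab} x_{cd}`. -/
def mon (idx : Fin n → Fin n → Fin m) (a b c d : Fin n) : Fin m →₀ ℕ :=
  Finsupp.single (idx a b) 1 + Finsupp.single (idx c d) 1

lemma sum_mon (a b c d : Fin n) : ∑ i, mon idx a b c d i = 2 := by
  simp [mon, Finset.sum_add_distrib, Finsupp.single_apply]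

lemma degD_single (i : Fin m) (j : Fin n) : degD e (Finsupp.single i 1) j = incid e i j := by
  rw [degD_apply]
  simp [Finsupp.single_apply]

lemma degD_mon (H : IsIdx e idx) {a b c d : Fin n} (hab : a ≠ b) (hcd : c ≠ d) (j : Fin n) :
    degD e (mon idx a b c d) j =
      (if j = a ∨ j = b then 1 else 0) + (if j = c ∨ j = d then 1 else 0) := by
  rw [mon, degD_add, Finsupp.add_apply, degD_single, degD_single]
  simp [incid, H.spec _ _ hab, H.spec _ _ hcd]

/-- The four-element subsets of the vertex set. -/
abbrev Quad (n : ℕ) : Type := {S : Finset (Fin n) // S ∈ Finset.powersetCard 4 Finset.univ}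

/-- Increasing enumeration of a four-element subset. -/
def Quad.vtx (S : Quad n) : Fin 4 ↪o Fin n :=
  S.1.orderEmbOfFin (Finset.mem_powersetCard.1 S.2).2

lemma Quad.mem_iff (S : Quad n) (j : Fin n) : j ∈ S.1 ↔
    j = S.vtx 0 ∨ j = S.vtx 1 ∨ j = S.vtx 2 ∨ j = S.vtx 3 := by
  have h := Finset.range_orderEmbOfFin S.1 (Finset.mem_powersetCard.1 S.2).2
  have h2 : j ∈ S.1 ↔ j ∈ Set.range S.vtx := by
    rw [Quad.vtx, h]; simp
  rw [h2, Set.mem_range]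
  simp [Fin.exists_fin_succ, eq_comm]

lemma Quad.ne (S : Quad n) {i j : Fin 4} (h : i ≠ j) : S.vtx i ≠ S.vtx j :=
  S.vtx.injective.ne h

/-- First exponent of the quadric. -/
def qU (idx : Fin n → Fin n → Fin m) (x : Quad n × Bool) : Fin m →₀ ℕ :=
  if x.2 then mon idx (x.1.vtx 0) (x.1.vtx 1) (x.1.vtx 2) (x.1.vtx 3)
  else mon idx (x.1.vtx 0) (x.1.vtx 2) (x.1.vtx 1) (x.1.vtx 3)

/-- Second exponent of the quadric. -/
def qV (idx : Fin n → Fin n → Fin m) (x : Quad n × Bool) : Fin m →₀ ℕ :=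
  mon idx (x.1.vtx 0) (x.1.vtx 3) (x.1.vtx 1) (x.1.vtx 2)

/-- The quadrics. -/
def quadric (K : Type*) [Field K] (idx : Fin n → Fin n → Fin m) (x : Quad n × Bool) :
    MvPolynomial (Fin m) K :=
  monomial (qU idx x) 1 - monomial (qV idx x) 1

lemma degD_qU (H : IsIdx e idx) (x : Quad n × Bool) (j : Fin n) :
    degD e (qU idx x) j = if j ∈ x.1.1 then 1 else 0 := by
  obtain ⟨S, b⟩ := x
  have h01 := S.ne (i := 0) (j := 1) (by decide)
  have h02 := S.ne (i := 0) (j := 2) (by decide)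
  have h03 := S.ne (i := 0) (j := 3) (by decide)
  have h12 := S.ne (i := 1) (j := 2) (by decide)
  have h13 := S.ne (i := 1) (j := 3) (by decide)
  have h23 := S.ne (i := 2) (j := 3) (by decide)
  simp only [S.mem_iff]
  cases b
  · simp only [qU]
    simp only [Bool.false_eq_true, if_false]
    rw [degD_mon H h02 h13]
    grind
  · simp only [qU]
    simp only [if_true]
    rw [degD_mon H h01 h23]
    grind

lemma degD_qV (H : IsIdx e idx) (x : Quad n × Bool) (j : Fin n) :
    degD e (qV idx x) j = if j ∈ x.1.1 then 1 else 0 := by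
  obtain ⟨S, b⟩ := x
  have h01 := S.ne (i := 0) (j := 1) (by decide)
  have h02 := S.ne (i := 0) (j := 2) (by decide)
  have h03 := S.ne (i := 0) (j := 3) (by decide)
  have h12 := S.ne (i := 1) (j := 2) (by decide)
  have h13 := S.ne (i := 1) (j := 3) (by decide)
  have h23 := S.ne (i := 2) (j := 3) (by decide)
  simp only [S.mem_iff]
  simp only [qV]
  rw [degD_mon H h03 h12]
  grind

lemma quadric_mem (H : IsIdx e idx) (x : Quad n × Bool) : quadric K idx x ∈ toricIdeal K e := by
  rw [quadric, toricMap_coeff_zero]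
  ext j
  rw [degD_qU H, degD_qV H]

lemma mkM_mon (J : Ideal (MvPolynomial (Fin m) K)) (a b c d : Fin n) :
    mkM J (mon idx a b c d) =
      mkM J (Finsupp.single (idx a b) 1) * mkM J (Finsupp.single (idx c d) 1) := by
  rw [mon, mkM_add]

lemma swap_abstract {R : Type*} [CommRing R] (y : Fin 4 → Fin 4 → R)
    (hs : ∀ i j, i ≠ j → y i j = y j i) (h1 : y 0 1 * y 2 3 = y 0 3 * y 1 2)
    (h2 : y 0 2 * y 1 3 = y 0 3 * y 1 2) (i j k l : Fin 4) (hij : i ≠ j) (hik : i ≠ k)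
    (hil : i ≠ l) (hjk : j ≠ k) (hjl : j ≠ l) (hkl : k ≠ l) :
    y i j * y k l = y i k * y j l := by
  have e10 := hs 1 0 (by decide)
  have e20 := hs 2 0 (by decide)
  have e30 := hs 3 0 (by decide)
  have e21 := hs 2 1 (by decide)
  have e31 := hs 3 1 (by decide)
  have e32 := hs 3 2 (by decide)
  clear hs
  fin_cases i <;> fin_cases j <;> first | (exact absurd rfl hij) | skip
  all_goals fin_cases k <;> first | (exact absurd rfl hik) | (exact absurd rfl hjk) | skip
  all_goals fin_cases l <;>
    first | (exact absurd rfl hil) | (exact absurd rfl hjl) | (exact absurd rfl hkl) | skip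
  all_goals
    simp only [Fin.zero_eta, Fin.mk_one, Fin.reduceFinMk, e10, e20, e30, e21, e31, e32]
    grind

lemma swapIdeal_quadrics (H : IsIdx e idx) :
    SwapIdeal (Ideal.span (Set.range (quadric K (n := n) idx))) idx := by
  set J := Ideal.span (Set.range (quadric K (n := n) idx)) with hJ
  intro a b c d hab hac had hbc hbd hcd
  let S : Quad n := ⟨{a, b, c, d}, by
    rw [Finset.mem_powersetCard]
    refine ⟨Finset.subset_univ _, ?_⟩
    rw [Finset.card_insert_of_notMem (by simp [*]), Finset.card_insert_of_notMem (by simp [*]),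
      Finset.card_pair hcd]⟩
  have hq : ∀ b, mkM J (qU idx (S, b)) = mkM J (qV idx (S, b)) := by
    intro b
    rw [mkM, mkM, Ideal.Quotient.eq]
    exact Ideal.subset_span ⟨(S, b), rfl⟩
  have h1 := hq true
  have h2 := hq false
  simp only [qU, qV, if_true, Bool.false_eq_true, if_false, mkM_mon] at h1 h2
  have hex : ∀ j ∈ S.1, ∃ i, S.vtx i = j := by
    intro j hj
    rcases (S.mem_iff j).1 hj with h | h | h | h <;> exact ⟨_, h.symm⟩
  obtain ⟨i, hi⟩ := hex a (by simp [S])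
  obtain ⟨j, hj⟩ := hex b (by simp [S])
  obtain ⟨k, hk⟩ := hex c (by simp [S])
  obtain ⟨l, hl⟩ := hex d (by simp [S])
  rw [← hi, ← hj, ← hk, ← hl]
  refine swap_abstract (fun i j => mkM J (Finsupp.single (idx (S.vtx i) (S.vtx j)) 1)) ?_ h1 h2
    i j k l ?_ ?_ ?_ ?_ ?_ ?_
  · intro i j hij
    simp only [H.symm (S.ne hij)]
  · rintro rfl; exact hab (hi.symm.trans hj)
  · rintro rfl; exact hac (hi.symm.trans hk)
  · rintro rfl; exact had (hi.symm.trans hl)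
  · rintro rfl; exact hbc (hj.symm.trans hk)
  · rintro rfl; exact hbd (hj.symm.trans hl)
  · rintro rfl; exact hcd (hk.symm.trans hl)

lemma toricIdeal_eq (H : IsIdx e idx) :
    Ideal.span (Set.range (quadric K (n := n) idx)) = toricIdeal K e := by
  have h : Ideal.span (Set.range (quadric K (n := n) idx)) ≤ toricIdeal K e := by
    rw [Ideal.span_le]
    rintro _ ⟨x, rfl⟩
    exact quadric_mem H x
  exact le_antisymm h (toricIdeal_le H _ (swapIdeal_quadrics H) h)

lemma card_index (n : ℕ) : Fintype.card (Quad n × Bool) = 2 * Nat.choose n 4 := by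
  rw [Fintype.card_prod, Fintype.card_coe, Finset.card_powersetCard]
  simp [mul_comm]

/-! ### Lower bound for the number of generators -/

lemma qU_sum (x : Quad n × Bool) : ∑ i, qU idx x i = 2 := by
  unfold qU; split_ifs <;> exact sum_mon _ _ _ _

lemma qV_sum (x : Quad n × Bool) : ∑ i, qV idx x i = 2 := sum_mon _ _ _ _

lemma eq_of_le_of_sum {u v : Fin m →₀ ℕ} (h : u ≤ v) (hs : ∑ i, u i = ∑ i, v i) : u = v := by
  ext i
  exact (Finset.sum_eq_sum_iff_of_le (fun i _ => h i)).1 hs i (Finset.mem_univ _)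

lemma quad_eq_of_degD (e : Fin m → Sym2 (Fin n)) (u v : Fin m →₀ ℕ) (S T : Quad n)
    (hu : ∀ j, degD e u j = if j ∈ S.1 then 1 else 0)
    (hv : ∀ j, degD e v j = if j ∈ T.1 then 1 else 0) (h : u = v) : S = T := by
  apply Subtype.ext
  ext j
  have h1 := hu j
  rw [h, hv j] at h1
  split_ifs at h1 <;> simp_all

lemma qU_ne_qV (H : IsIdx e idx) (x y : Quad n × Bool) : qU idx x ≠ qV idx y := by
  intro h
  have hS := quad_eq_of_degD e _ _ _ _ (degD_qU H x) (degD_qV H y) h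
  obtain ⟨S, b⟩ := x
  obtain ⟨T, c⟩ := y
  obtain rfl : S = T := hS
  have h01 := S.ne (i := 0) (j := 1) (by decide)
  have h02 := S.ne (i := 0) (j := 2) (by decide)
  have h03 := S.ne (i := 0) (j := 3) (by decide)
  have h12 := S.ne (i := 1) (j := 2) (by decide)
  have h13 := S.ne (i := 1) (j := 3) (by decide)
  have h23 := S.ne (i := 2) (j := 3) (by decide)
  have := DFunLike.congr_fun h (idx (S.vtx 0) (S.vtx 3))
  cases b <;>
  simp [qU, qV, mon, Finsupp.single_apply, H.eq_iff, h01, h02, h03, h12, h13, h23, h01.symm,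
    h02.symm, h03.symm, h12.symm, h13.symm, h23.symm] at this

lemma qU_inj (H : IsIdx e idx) (x y : Quad n × Bool) (h : qU idx x = qU idx y) : x = y := by
  have hS := quad_eq_of_degD e _ _ _ _ (degD_qU H x) (degD_qU H y) h
  obtain ⟨S, b⟩ := x
  obtain ⟨T, c⟩ := y
  obtain rfl : S = T := hS
  have h01 := S.ne (i := 0) (j := 1) (by decide)
  have h02 := S.ne (i := 0) (j := 2) (by decide)
  have h03 := S.ne (i := 0) (j := 3) (by decide)
  have h12 := S.ne (i := 1) (j := 2) (by decide)
  have h13 := S.ne (i := 1) (j := 3) (by decide)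
  have h23 := S.ne (i := 2) (j := 3) (by decide)
  have := DFunLike.congr_fun h (idx (S.vtx 0) (S.vtx 1))
  cases b <;> cases c <;> first | rfl | skip
  all_goals
    simp [qU, mon, Finsupp.single_apply, H.eq_iff, h01, h02, h03, h12, h13, h23, h01.symm,
      h02.symm, h03.symm, h12.symm, h13.symm, h23.symm] at this

/-- The coefficients at the leading exponents. -/
def coeffMap (K : Type*) [Field K] (idx : Fin n → Fin n → Fin m) :
    MvPolynomial (Fin m) K →ₗ[K] (Quad n × Bool → K) :=
  LinearMap.pi fun x => lcoeff K (qU idx x)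

lemma coeffMap_apply (p : MvPolynomial (Fin m) K) (x : Quad n × Bool) :
    coeffMap K idx p x = coeff (qU idx x) p := rfl

lemma coeffMap_mul_quadric (H : IsIdx e idx) (p : MvPolynomial (Fin m) K) (x : Quad n × Bool) :
    coeffMap K idx (p * quadric K idx x) = coeff 0 p • Pi.single x 1 := by
  classical
  funext y
  rw [coeffMap_apply, quadric, mul_sub, coeff_sub, coeff_mul_monomial', coeff_mul_monomial']
  have h2 : ¬ qV idx x ≤ qU idx y := by
    intro h
    exact qU_ne_qV H y x (eq_of_le_of_sum h (by rw [qU_sum, qV_sum])).symm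
  rw [if_neg h2]
  by_cases hxy : x = y
  · subst hxy
    simp
  · have h1 : ¬ qU idx x ≤ qU idx y := by
      intro h
      exact hxy (qU_inj H _ _ (eq_of_le_of_sum h (by rw [qU_sum, qU_sum])))
    rw [if_neg h1]
    simp [Pi.single_apply, Ne.symm hxy]

lemma coeffMap_mul (H : IsIdx e idx) (c f : MvPolynomial (Fin m) K) (hf : f ∈ toricIdeal K e) :
    coeffMap K idx (c * f) = coeff 0 c • coeffMap K idx f := by
  rw [← toricIdeal_eq H, Ideal.mem_span_range_iff_exists_fun] at hf
  obtain ⟨a, rfl⟩ := hf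
  rw [Finset.mul_sum, map_sum, map_sum, Finset.smul_sum]
  refine Finset.sum_congr rfl fun x _ => ?_
  rw [← mul_assoc, coeffMap_mul_quadric H, coeffMap_mul_quadric H, smul_smul]
  congr 1
  simp [← constantCoeff_eq]

lemma mu_lower (H : IsIdx e idx) (s : ℕ) (F : Fin s → MvPolynomial (Fin m) K)
    (hF : Ideal.span (Set.range F) = toricIdeal K e) : 2 * Nat.choose n 4 ≤ s := by
  classical
  have hspan : Submodule.span K (Set.range fun i => coeffMap K idx (F i)) = ⊤ := by
    rw [eq_top_iff, ← (Pi.basisFun K (Quad n × Bool)).span_eq, Submodule.span_le]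
    rintro _ ⟨x, rfl⟩
    have hx : quadric K idx x ∈ toricIdeal K e := quadric_mem H x
    rw [← hF, Ideal.mem_span_range_iff_exists_fun] at hx
    obtain ⟨c, hc⟩ := hx
    have h1 := coeffMap_mul_quadric H (1 : MvPolynomial (Fin m) K) x
    rw [one_mul, ← hc, map_sum] at h1
    have h2 : (Pi.basisFun K (Quad n × Bool)) x =
        ∑ i, coeff 0 (c i) • coeffMap K idx (F i) := by
      rw [Pi.basisFun_apply]
      have h3 : (Pi.single x 1 : Quad n × Bool → K) =
        coeff 0 (1 : MvPolynomial (Fin m) K) • Pi.single x 1 := by simp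
      rw [h3, ← h1]
      refine Finset.sum_congr rfl fun i _ => ?_
      exact coeffMap_mul H _ _ (by rw [← hF]; exact Ideal.subset_span ⟨i, rfl⟩)
    rw [h2]
    exact Submodule.sum_mem _ fun i _ => Submodule.smul_mem _ _ (Submodule.subset_span ⟨i, rfl⟩)
  have h := finrank_range_le_card (R := K) (fun i => coeffMap K idx (F i))
  rw [Set.finrank, hspan, finrank_top, Module.finrank_fintype_fun_eq_card, card_index] at h
  simpa using h

/-! ### Lower bound for the homogeneous arithmetical rank -/

/-- Set to zero all variables whose edges are not contained in `S`. -/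
def restr (K : Type*) [Field K] (e : Fin m → Sym2 (Fin n)) (S : Finset (Fin n)) :
    MvPolynomial (Fin m) K →ₐ[K] MvPolynomial (Fin m) K :=
  by
    classical
    exact aeval fun i => if ∀ j ∈ e i, j ∈ S then X i else 0

lemma restr_monomial_of (S : Finset (Fin n)) (u : Fin m →₀ ℕ) (c : K)
    (h : ∀ j, degD e u j ≠ 0 → j ∈ S) : restr K e S (monomial u c) = monomial u c := by
  classical
  unfold restr
  rw [aeval_monomial, monomial_eq, algebraMap_eq]
  congr 1
  refine Finsupp.prod_congr fun i hi => ?_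
  rw [if_pos]
  intro j hj
  exact h j ((degD_ne_zero e u j).2 ⟨i, Finsupp.mem_support_iff.1 hi, hj⟩)

lemma restr_monomial_not (S : Finset (Fin n)) (u : Fin m →₀ ℕ) (c : K)
    (j : Fin n) (hj : degD e u j ≠ 0) (hjS : j ∉ S) : restr K e S (monomial u c) = 0 := by
  classical
  obtain ⟨i, hi, hji⟩ := (degD_ne_zero e u j).1 hj
  unfold restr
  rw [aeval_monomial]
  have : (u.prod fun i k => (if ∀ j ∈ e i, j ∈ S then (X i : MvPolynomial (Fin m) K) else 0) ^ k)
      = 0 := by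
    refine Finset.prod_eq_zero (i := i) (Finsupp.mem_support_iff.2 hi) ?_
    simp only
    rw [if_neg, zero_pow hi]
    intro h
    exact hjS (h j hji)
  rw [this, mul_zero]

/-- Vertex support of a polynomial. -/
def vsupp (e : Fin m → Sym2 (Fin n)) (p : MvPolynomial (Fin m) K) : Finset (Fin n) :=
  p.support.biUnion fun u => (degD e u).support

lemma restr_of_subset (S : Finset (Fin n)) (p : MvPolynomial (Fin m) K) (h : vsupp e p ⊆ S) :
    restr K e S p = p := by
  conv_lhs => rw [p.as_sum]
  conv_rhs => rw [p.as_sum]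
  rw [map_sum]
  refine Finset.sum_congr rfl fun u hu => ?_
  apply restr_monomial_of
  intro j hj
  apply h
  rw [vsupp, Finset.mem_biUnion]
  exact ⟨u, hu, Finsupp.mem_support_iff.2 hj⟩

lemma restr_of_not_subset (S : Finset (Fin n)) (p : MvPolynomial (Fin m) K)
    (hp : IsGHomogeneous e p) (h : ¬ vsupp e p ⊆ S) : restr K e S p = 0 := by
  rw [Finset.not_subset] at h
  obtain ⟨j, hj, hjS⟩ := h
  rw [vsupp, Finset.mem_biUnion] at hj
  obtain ⟨u, hu, huj⟩ := hj
  rw [p.as_sum, map_sum]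
  refine Finset.sum_eq_zero fun v hv => ?_
  refine restr_monomial_not S v _ j ?_ hjS
  rw [(degG_eq_iff e v u).1 (hp v hv u hu)]
  exact Finsupp.mem_support_iff.1 huj

lemma eq_zero_of_small (H : IsIdx e idx) (p : MvPolynomial (Fin m) K) (hp : p ∈ toricIdeal K e)
    (hc : (vsupp e p).card < 4) : p = 0 := by
  have h1 : toricIdeal K e ≤ RingHom.ker (restr K e (vsupp e p)) := by
    rw [← toricIdeal_eq H, Ideal.span_le]
    rintro _ ⟨x, rfl⟩
    have : ∃ j ∈ x.1.1, j ∉ vsupp e p := by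
      rw [← Finset.not_subset]
      intro hsub
      have := Finset.card_le_card hsub
      rw [(Finset.mem_powersetCard.1 x.1.2).2] at this
      omega
    obtain ⟨j, hj, hjn⟩ := this
    simp only [SetLike.mem_coe, RingHom.mem_ker]
    rw [quadric, map_sub, restr_monomial_not _ _ _ j _ hjn, restr_monomial_not _ _ _ j _ hjn,
      sub_zero]
    · rw [degD_qV H]; simp [hj]
    · rw [degD_qU H]; simp [hj]
  have h2 := h1 hp
  rw [RingHom.mem_ker, restr_of_subset _ _ subset_rfl] at h2
  exact h2

lemma restr_eq_zero (H : IsIdx e idx) (S : Quad n) (p : MvPolynomial (Fin m) K)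
    (hp : p ∈ toricIdeal K e) (hph : IsGHomogeneous e p) (h : vsupp e p ≠ S.1) :
    restr K e S.1 p = 0 := by
  by_cases hs : vsupp e p ⊆ S.1
  · have : (vsupp e p).card < 4 := by
      rw [← (Finset.mem_powersetCard.1 S.2).2]
      exact Finset.card_lt_card (Finset.ssubset_iff_subset_ne.2 ⟨hs, h⟩)
    rw [eq_zero_of_small H p hp this, map_zero]
  · exact restr_of_not_subset _ _ hph hs

lemma restr_quadric (H : IsIdx e idx) (x : Quad n × Bool) :
    restr K e x.1.1 (quadric K idx x) = quadric K idx x := by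
  rw [quadric, map_sub, restr_monomial_of, restr_monomial_of]
  · intro j; rw [degD_qV H]; simp
  · intro j; rw [degD_qU H]; simp

lemma quadric_ne_zero (H : IsIdx e idx) (x : Quad n × Bool) : quadric K idx x ≠ 0 := by
  rw [quadric, sub_ne_zero, Ne, monomial_left_inj one_ne_zero]
  exact qU_ne_qV H x x

lemma quadric_sub_ne_zero (H : IsIdx e idx) (S : Quad n) :
    quadric K idx (S, true) - quadric K idx (S, false) ≠ 0 := by
  have : quadric K idx (S, true) - quadric K idx (S, false) =
    monomial (qU idx (S, true)) 1 - monomial (qU idx (S, false)) 1 := by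
    simp [quadric, qV]
  rw [this, sub_ne_zero, Ne, monomial_left_inj one_ne_zero]
  intro h
  simpa using qU_inj H _ _ h

lemma degreeOf_binom (u v : Fin m →₀ ℕ) (i : Fin m) (hu : u i = 0) (hv : v i = 0) :
    degreeOf i (monomial u (1 : K) - monomial v 1) = 0 := by
  classical
  have h := degreeOf_sub_le i (monomial u (1 : K)) (monomial v 1)
  rw [degreeOf_monomial_eq u i one_ne_zero, degreeOf_monomial_eq v i one_ne_zero, hu, hv] at h
  simpa using h

lemma degreeOf_of_dvd (g q : MvPolynomial (Fin m) K) (k : ℕ) (i : Fin m) (hq : q ≠ 0)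
    (h : g ∣ q ^ k) (hd : degreeOf i q = 0) : degreeOf i g = 0 := by
  obtain ⟨r, hr⟩ := h
  have h0 : q ^ k ≠ 0 := pow_ne_zero _ hq
  have hg : g ≠ 0 := by rintro rfl; simp [hr] at h0
  have hr0 : r ≠ 0 := by rintro rfl; simp [hr] at h0
  have h1 := degreeOf_mul_eq (n := i) hg hr0
  rw [← hr, degreeOf_pow_eq _ _ _ hq, hd] at h1
  omega

lemma some_quadric_free (H : IsIdx e idx) (S : Quad n) (i : Fin m) :
    (qU idx (S, true) i = 0 ∧ qU idx (S, false) i = 0) ∨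
    (qU idx (S, true) i = 0 ∧ qV idx (S, true) i = 0) ∨
    (qU idx (S, false) i = 0 ∧ qV idx (S, false) i = 0) := by
  have h01 := S.ne (i := 0) (j := 1) (by decide)
  have h02 := S.ne (i := 0) (j := 2) (by decide)
  have h03 := S.ne (i := 0) (j := 3) (by decide)
  have h12 := S.ne (i := 1) (j := 2) (by decide)
  have h13 := S.ne (i := 1) (j := 3) (by decide)
  have h23 := S.ne (i := 2) (j := 3) (by decide)
  obtain ⟨a, b, hab, rfl⟩ := H.surj i
  simp only [qU, qV, mon, Finsupp.add_apply, Finsupp.single_apply, if_true, Bool.false_eq_true,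
    if_false, H.eq_iff h01 hab, H.eq_iff h02 hab, H.eq_iff h03 hab, H.eq_iff h12 hab,
    H.eq_iff h13 hab, H.eq_iff h23 hab]
  grind

lemma no_principal (H : IsIdx e idx) (S : Quad n) (g : MvPolynomial (Fin m) K)
    (hg : g ∈ toricIdeal K e)
    (h : ∀ q ∈ toricIdeal K e, restr K e S.1 q = q → ∃ k : ℕ, g ∣ q ^ k) : False := by
  have hq1 := quadric_mem (K := K) H (S, true)
  have hq2 := quadric_mem (K := K) H (S, false)
  have hr1 := restr_quadric (K := K) H (S, true)
  have hr2 := restr_quadric (K := K) H (S, false)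
  obtain ⟨k1, hk1⟩ := h _ hq1 hr1
  obtain ⟨k2, hk2⟩ := h _ hq2 hr2
  obtain ⟨k3, hk3⟩ := h _ (sub_mem hq1 hq2) (by rw [map_sub, hr1, hr2])
  have hdeg : ∀ i, degreeOf i g = 0 := by
    intro i
    rcases some_quadric_free H S i with ⟨h1, h2⟩ | ⟨h1, h2⟩ | ⟨h1, h2⟩
    · refine degreeOf_of_dvd g _ k3 i (quadric_sub_ne_zero H S) hk3 ?_
      have : quadric K idx (S, true) - quadric K idx (S, false) =
        monomial (qU idx (S, true)) 1 - monomial (qU idx (S, false)) 1 := by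
        simp [quadric, qV]
      rw [this]
      exact degreeOf_binom _ _ i h1 h2
    · exact degreeOf_of_dvd g _ k1 i (quadric_ne_zero H _) hk1 (degreeOf_binom _ _ i h1 h2)
    · exact degreeOf_of_dvd g _ k2 i (quadric_ne_zero H _) hk2 (degreeOf_binom _ _ i h1 h2)
  have hC : g = C (coeff 0 g) := by
    ext u
    rw [coeff_C]
    split_ifs with h0
    · rw [h0]
    · by_contra hne
      apply h0
      ext i
      have := (degreeOf_le_iff (n := i) (f := g) (d := 0)).1 (hdeg i).le u (mem_support_iff.2 hne)
      simp only [Finsupp.coe_zero, Pi.zero_apply]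
      omega
  rw [hC, toricIdeal, RingHom.mem_ker] at hg
  have hg0 : g = 0 := by
    rw [hC]
    have h1 : (C (coeff 0 g) : MvPolynomial (Fin n) K) = 0 := by
      rw [← hg]; exact (AlgHom.commutes (toricMap K e) _).symm
    rw [C_eq_zero] at h1
    rw [h1, C_0]
  rw [hg0, zero_dvd_iff] at hk1
  exact pow_ne_zero _ (quadric_ne_zero H _) hk1

lemma araG_lower (H : IsIdx e idx) (s : ℕ) (F : Fin s → MvPolynomial (Fin m) K)
    (hhom : ∀ i, IsGHomogeneous e (F i)) (hmem : ∀ i, F i ∈ toricIdeal K e)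
    (hF : (Ideal.span (Set.range F)).radical = toricIdeal K e) : 2 * Nat.choose n 4 ≤ s := by
  classical
  have key : ∀ S ∈ Finset.powersetCard 4 (Finset.univ : Finset (Fin n)),
      2 ≤ (Finset.univ.filter fun i => vsupp e (F i) = S).card := by
    intro S hS
    by_contra hlt
    have hle : (Finset.univ.filter fun i => vsupp e (F i) = S).card ≤ 1 := by omega
    have hex : ∃ g ∈ toricIdeal K e, ∀ i, g ∣ restr K e S (F i) := by
      by_cases hi : ∃ i0, vsupp e (F i0) = S
      · obtain ⟨i0, hi0⟩ := hi
        refine ⟨F i0, hmem i0, fun i => ?_⟩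
        by_cases hii : vsupp e (F i) = S
        · have : i = i0 := Finset.card_le_one.1 hle i (by simp [hii]) i0 (by simp [hi0])
          rw [this, restr_of_subset _ _ hi0.subset]
        · rw [restr_eq_zero H ⟨S, hS⟩ (F i) (hmem i) (hhom i) hii]
          exact dvd_zero _
      · push Not at hi
        refine ⟨0, zero_mem _, fun i => ?_⟩
        rw [restr_eq_zero H ⟨S, hS⟩ (F i) (hmem i) (hhom i) (hi i)]
    obtain ⟨g, hg, hdvd⟩ := hex
    refine no_principal H ⟨S, hS⟩ g hg fun q hq hqr => ?_
    rw [← hF] at hq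
    obtain ⟨k, hk⟩ := hq
    refine ⟨k, ?_⟩
    rw [Ideal.mem_span_range_iff_exists_fun] at hk
    obtain ⟨c, hc⟩ := hk
    have h1 : q ^ k = ∑ i, restr K e S (c i) * restr K e S (F i) := by
      rw [← hqr]
      simp only
      rw [← map_pow, ← hc, map_sum]
      simp
    rw [h1]
    exact Finset.dvd_sum fun i _ => Dvd.dvd.mul_left (hdvd i) _
  have h2 := Finset.card_nsmul_le_sum _ _ _ key
  rw [Finset.card_powersetCard, Finset.card_univ, Fintype.card_fin] at h2
  have h3 : ∑ S ∈ Finset.powersetCard 4 (Finset.univ : Finset (Fin n)),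
      (Finset.univ.filter fun i => vsupp e (F i) = S).card ≤ s := by
    rw [← Finset.card_biUnion]
    · exact (Finset.card_le_univ _).trans (by simp)
    · intro S _ T _ hST
      rw [Function.onFun, Finset.disjoint_left]
      intro i hi hi'
      simp only [Finset.mem_filter] at hi hi'
      exact hST (hi.2.symm.trans hi'.2)
  rw [smul_eq_mul] at h2
  omega

lemma binomial_homogeneous (p : MvPolynomial (Fin m) K) (hb : IsBinomial p)
    (hp : p ∈ toricIdeal K e) : IsGHomogeneous e p := by
  classical
  obtain ⟨u, v, rfl⟩ := hb
  have huv := (toricMap_coeff_zero e u v).1 hp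
  have hs : ∀ w ∈ (monomial u (1 : K) - monomial v 1).support, degD e w = degD e v := by
    intro w hw
    rw [mem_support_iff, coeff_sub, coeff_monomial, coeff_monomial] at hw
    by_cases h1 : u = w
    · rw [← h1, huv]
    · by_cases h2 : v = w
      · rw [h2]
      · simp [h1, h2] at hw
  intro w hw w' hw'
  rw [degG_eq_iff, hs w hw, hs w' hw']

end Quadrics

lemma count_formula (n : ℕ) : n * (n - 1) * (n - 2) * (n - 3) / 12 = 2 * Nat.choose n 4 := by
  have h := Nat.descFactorial_eq_factorial_mul_choose n 4
  have h2 : n.descFactorial 4 = n * (n - 1) * (n - 2) * (n - 3) := by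
    simp only [Nat.descFactorial, tsub_zero, mul_one]
    ring
  rw [← h2, h]
  have : Nat.factorial 4 = 24 := rfl
  rw [this]
  omega

lemma exists_idx {n m : ℕ} (hn : 4 ≤ n) (e : Fin m → Sym2 (Fin n))
    (he : Function.Injective e) (hrange : Set.range e = {s : Sym2 (Fin n) | ¬ s.IsDiag}) :
    ∃ idx, IsIdx e idx := by
  have h0 : ∀ a b : Fin n, a ≠ b → ∃ i, e i = s(a, b) := by
    intro a b hab
    have : s(a, b) ∈ Set.range e := by rw [hrange]; simpa using hab
    exact this
  have h1 : ∀ a b : Fin n, ∃ i, a ≠ b → e i = s(a, b) := by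
    intro a b
    by_cases hab : a = b
    · obtain ⟨i, -⟩ := h0 ⟨0, by omega⟩ ⟨1, by omega⟩ (by simp)
      exact ⟨i, fun h => absurd hab h⟩
    · obtain ⟨i, hi⟩ := h0 a b hab
      exact ⟨i, fun _ => hi⟩
  choose idx hidx using h1
  refine ⟨idx, he, hidx, fun i => ?_⟩
  have hi : e i ∈ Set.range e := ⟨i, rfl⟩
  rw [hrange] at hi
  obtain ⟨a, b, hab⟩ : ∃ a b, e i = s(a, b) := by
    induction h : e i using Sym2.ind with
    | _ a b => exact ⟨a, b, rfl⟩
  have hne : a ≠ b := by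
    rintro rfl
    rw [hab] at hi
    simp at hi
  exact ⟨a, b, hne, he (by rw [hab, hidx a b hne])⟩

lemma sInf_eq_of {A : Set ℕ} {N : ℕ} (h1 : N ∈ A) (h2 : ∀ s ∈ A, N ≤ s) : sInf A = N :=
  le_antisymm (Nat.sInf_le h1) (le_csInf ⟨N, h1⟩ h2)

/-- For the complete graph `K_n`, `n ≥ 4` (the edges `e` enumerate all
two-element subsets of the vertices), the minimal number of generators of `I_{K_n}` is
`2·C(n,4) = n(n-1)(n-2)(n-3)/12`, and both the binomial arithmetical rank and the
`K_n`-homogeneous arithmetical rank of `I_{K_n}` equal this number. -/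
theorem bar_araG_completeGraph {K : Type*} [Field K] [IsAlgClosed K]
    {n m : ℕ} (hn : 4 ≤ n) (e : Fin m → Sym2 (Fin n))
    (he : Function.Injective e) (hrange : Set.range e = {s : Sym2 (Fin n) | ¬ s.IsDiag})
 :
    mu (toricIdeal K e) = 2 * Nat.choose n 4 ∧
    mu (toricIdeal K e) = n * (n - 1) * (n - 2) * (n - 3) / 12 ∧
    bar (toricIdeal K e) = n * (n - 1) * (n - 2) * (n - 3) / 12 ∧
    araG e (toricIdeal K e) = n * (n - 1) * (n - 2) * (n - 3) / 12 := by
  obtain ⟨idx, H⟩ := exists_idx hn e he hrange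
  rw [count_formula]
  let φ : Fin (2 * Nat.choose n 4) ≃ Quad n × Bool :=
    (Fintype.equivFinOfCardEq (card_index n)).symm
  let G : Fin (2 * Nat.choose n 4) → MvPolynomial (Fin m) K := fun i => quadric K idx (φ i)
  have hr : Set.range G = Set.range (quadric K (n := n) idx) :=
    φ.surjective.range_comp (quadric K (n := n) idx)
  have hspan : Ideal.span (Set.range G) = toricIdeal K e := by rw [hr, toricIdeal_eq H]
  have hbin : ∀ i, IsBinomial (G i) := fun i => ⟨_, _, rfl⟩
  have hmem : ∀ i, G i ∈ toricIdeal K e := fun i => quadric_mem H _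
  have hprime : (toricIdeal K e).IsPrime := RingHom.ker_isPrime _
  have hrad : (Ideal.span (Set.range G)).radical = toricIdeal K e := by
    rw [hspan, hprime.radical]
  have hmu : mu (toricIdeal K e) = 2 * Nat.choose n 4 :=
    sInf_eq_of ⟨G, hspan⟩ (by rintro s ⟨F, hF⟩; exact mu_lower H s F hF)
  refine ⟨hmu, hmu, ?_, ?_⟩
  · refine sInf_eq_of ⟨G, hbin, hmem, hrad⟩ ?_
    rintro s ⟨F, hb, hF, hR⟩
    exact araG_lower H s F (fun i => binomial_homogeneous _ (hb i) (hF i)) hF hR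
  · refine sInf_eq_of ⟨G, fun i => binomial_homogeneous _ (hbin i) (hmem i), hmem, hrad⟩ ?_
    rintro s ⟨F, hb, hF, hR⟩
    exact araG_lower H s F hb hF hR
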